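/- arXiv:2301.12877 — 2 statements merged into one kernel-verified Lean document; each statement's English description precedes it below -/
import Mathlib

section
/- Let d ≥ 1, p > 2, and let u ∈ C_c^∞(ℝ^d; ℝ). Then the function x ↦ |u(x)|^{p/2} is continuously differentiable with gradient ∇(|u|^{p/2}) = (p/2) |u|^{(p−2)/2} sign(u) ∇u, and the dissipation identity p ∫_{ℝ^d} |u|^{p−2} u Δu dx = −p(p−1) ∫_{ℝ^d} |u|^{p−2} |∇u|² dx = −(4(p−1)/p) ∫_{ℝ^d} |∇(|u|^{p/2})|² dx holds. -/
open MeasureTheory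

/-- The Laplacian `Δu = ∑_i ∂²u/∂x_i²` of a scalar function on `ℝ^d`. -/
noncomputable def lap (d : ℕ) (u : EuclideanSpace ℝ (Fin d) → ℝ)
    (x : EuclideanSpace ℝ (Fin d)) : ℝ :=
  ∑ i : Fin d,
    fderiv ℝ (fun y => fderiv ℝ u y (EuclideanSpace.single i 1)) x (EuclideanSpace.single i 1)

theorem hasDerivAt_abs_rpow_mul_self {q : ℝ} (hq : 0 < q) (t : ℝ) :
    HasDerivAt (fun s : ℝ => |s| ^ q * s) ((q + 1) * |t| ^ q) t := by
  have hne : ∀ s : ℝ, s ≠ 0 →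
      HasDerivAt (fun s : ℝ => |s| ^ q * s) ((q + 1) * |s| ^ q) s := by
    intro s hs
    have h := ((hasDerivAt_abs hs).rpow_const (p := q) (Or.inl (abs_ne_zero.2 hs))).mul
      (hasDerivAt_id s)
    refine h.congr_deriv ?_
    have hpow : |s| ^ q = |s| ^ (q - 1) * |s| := by
      rw [Real.rpow_sub_one (abs_ne_zero.2 hs), div_mul_cancel₀ _ (abs_ne_zero.2 hs)]
    have hsign : (SignType.sign s : ℝ) * s = |s| := sign_mul_self s
    simp only [id, mul_one]
    rw [hpow]
    linear_combination q * |s| ^ (q - 1) * hsign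
  have hcont : Continuous fun s : ℝ => |s| ^ q :=
    continuous_abs.rpow_const fun _ => Or.inr hq.le
  rcases eq_or_ne t 0 with rfl | ht
  · exact hasDerivAt_of_hasDerivAt_of_ne (g := fun s => (q + 1) * |s| ^ q) hne
      (hcont.mul continuous_id).continuousAt (continuous_const.mul hcont).continuousAt
  · exact hne t ht

theorem hasDerivAt_abs_rpow_sign {q : ℝ} (hq : 1 < q) (t : ℝ) :
    HasDerivAt (fun s : ℝ => |s| ^ q) (q * |t| ^ (q - 1) * Real.sign t) t := by
  refine (hasDerivAt_abs_rpow t hq).congr_deriv ?_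
  rcases eq_or_ne t 0 with rfl | ht
  · simp
  · have hpow : |t| ^ (q - 1) = |t| ^ (q - 2) * |t| := by
      rw [← Real.rpow_add_one (abs_ne_zero.2 ht)]
      ring_nf
    rw [hpow]
    rcases lt_or_gt_of_ne ht with h | h
    · rw [Real.sign_of_neg h, abs_of_neg h]; ring
    · rw [Real.sign_of_pos h, abs_of_pos h]; ring

theorem HasDerivAt.comp_gradient {F : Type*} [NormedAddCommGroup F] [InnerProductSpace ℝ F]
    [CompleteSpace F] {f : ℝ → ℝ} {f' : ℝ} {u : F → ℝ} {x : F}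
    (hf : HasDerivAt f f' (u x)) (hu : DifferentiableAt ℝ u x) :
    gradient (fun y => f (u y)) x = f' • gradient u x := by
  have h : fderiv ℝ (fun y => f (u y)) x = f' • fderiv ℝ u x :=
    (hf.comp_hasFDerivAt x hu.hasFDerivAt).fderiv
  simp [gradient, h]

theorem sum_sq_fderiv_single {ι : Type*} [Fintype ι] [DecidableEq ι]
    (u : EuclideanSpace ℝ ι → ℝ) (x : EuclideanSpace ℝ ι) :
    ∑ i, fderiv ℝ u x (EuclideanSpace.single i 1) ^ 2 = ‖gradient u x‖ ^ 2 := by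
  rw [EuclideanSpace.real_norm_sq_eq]
  refine Finset.sum_congr rfl fun i _ => ?_
  rw [← inner_gradient_left, EuclideanSpace.inner_single_right]
  simp

/-- Integration by parts in the direction `v` against a nonlinearity `φ ∘ u`. -/
theorem integral_comp_mul_fderiv_fderiv {E : Type*} [NormedAddCommGroup E] [NormedSpace ℝ E]
    [MeasurableSpace E] [BorelSpace E] [FiniteDimensional ℝ E]
    (μ : Measure E) [μ.IsAddHaarMeasure] {φ φ' : ℝ → ℝ}
    (hφ : ∀ t, HasDerivAt φ (φ' t) t) (hφ' : Continuous φ') {u : E → ℝ}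
    (hu : ContDiff ℝ 2 u) (hsupp : HasCompactSupport u) (v : E) :
    Integrable (fun x => φ (u x) * fderiv ℝ (fun y => fderiv ℝ u y v) x v) μ ∧
    Integrable (fun x => φ' (u x) * fderiv ℝ u x v ^ 2) μ ∧
    ∫ x, φ (u x) * fderiv ℝ (fun y => fderiv ℝ u y v) x v ∂μ
      = -∫ x, φ' (u x) * fderiv ℝ u x v ^ 2 ∂μ := by
  have hg : ContDiff ℝ 1 fun y => fderiv ℝ u y v :=
    (hu.fderiv_right (m := 1) (by norm_num)).clm_apply contDiff_const
  have hgsupp : HasCompactSupport fun y => fderiv ℝ u y v := hsupp.fderiv_apply ℝ v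
  have hφc : Continuous φ := continuous_iff_continuousAt.2 fun t => (hφ t).continuousAt
  have hf : ∀ x, HasFDerivAt (fun y => φ (u y)) (φ' (u x) • fderiv ℝ u x) x := fun x =>
    (hφ (u x)).comp_hasFDerivAt x (hu.differentiable (by norm_num) x).hasFDerivAt
  have hfc : Continuous fun x => φ (u x) := hφc.comp hu.continuous
  have hf'c : Continuous fun x => φ' (u x) := hφ'.comp hu.continuous
  have hdg : Continuous fun x => fderiv ℝ (fun y => fderiv ℝ u y v) x v :=
    (hg.continuous_fderiv (by norm_num)).clm_apply continuous_const
  have hint₁ : Integrable (fun x => φ (u x) * fderiv ℝ (fun y => fderiv ℝ u y v) x v) μ :=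
    (hfc.mul hdg).integrable_of_hasCompactSupport (hgsupp.fderiv_apply ℝ v).mul_left
  have heq : ∀ x, fderiv ℝ (fun y => φ (u y)) x v * fderiv ℝ u x v
      = φ' (u x) * fderiv ℝ u x v ^ 2 := fun x => by
    rw [(hf x).fderiv, smul_apply, smul_eq_mul]
    ring
  have hint₂ : Integrable (fun x => φ' (u x) * fderiv ℝ u x v ^ 2) μ := by
    simp_rw [pow_two]
    exact (hf'c.mul (hg.continuous.mul hg.continuous)).integrable_of_hasCompactSupport
      hgsupp.mul_left.mul_left
  refine ⟨hint₁, hint₂, ?_⟩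
  rw [integral_mul_fderiv_eq_neg_fderiv_mul_of_integrable (f := fun y => φ (u y))
    (by simpa only [heq] using hint₂) hint₁
    ((hfc.mul hg.continuous).integrable_of_hasCompactSupport hgsupp.mul_left)
    (fun x _ => (hf x).differentiableAt) (fun x _ => hg.differentiable (by norm_num) x)]
  simp only [heq]

theorem integral_comp_mul_lap {d : ℕ} {φ φ' : ℝ → ℝ} (hφ : ∀ t, HasDerivAt φ (φ' t) t)
    (hφ' : Continuous φ') {u : EuclideanSpace ℝ (Fin d) → ℝ} (hu : ContDiff ℝ 2 u)
    (hsupp : HasCompactSupport u) :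
    ∫ x, φ (u x) * lap d u x = -∫ x, φ' (u x) * ‖gradient u x‖ ^ 2 := by
  have h := fun i : Fin d => integral_comp_mul_fderiv_fderiv volume hφ hφ' hu hsupp
    (EuclideanSpace.single i 1)
  simp_rw [lap, ← sum_sq_fderiv_single, Finset.mul_sum]
  rw [integral_finsetSum _ fun i _ => (h i).1, integral_finsetSum _ fun i _ => (h i).2.1,
    ← Finset.sum_neg_distrib]
  exact Finset.sum_congr rfl fun i _ => (h i).2.2

/-- For `p > 2` and `u ∈ C_c^∞(ℝ^d)`, the function `|u|^{p/2}` is `C¹` with gradient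
`(p/2)|u|^{(p−2)/2} sign(u) ∇u`, and
`p ∫ |u|^{p−2} u Δu = −p(p−1) ∫ |u|^{p−2} |∇u|² = −(4(p−1)/p) ∫ |∇(|u|^{p/2})|²`. -/
theorem dissipation_identity (d : ℕ) (hd : 1 ≤ d) (p : ℝ) (hp : 2 < p)
    (u : EuclideanSpace ℝ (Fin d) → ℝ) (hu : ContDiff ℝ (⊤ : ℕ∞) u)
    (hsupp : HasCompactSupport u) :
    ContDiff ℝ 1 (fun x => |u x| ^ (p / 2)) ∧
    (∀ x, gradient (fun y => |u y| ^ (p / 2)) x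
        = (p / 2 * |u x| ^ ((p - 2) / 2) * Real.sign (u x)) • gradient u x) ∧
    p * (∫ x, |u x| ^ (p - 2) * u x * lap d u x)
      = -(p * (p - 1)) * ∫ x, |u x| ^ (p - 2) * ‖gradient u x‖ ^ 2 ∧
    p * (∫ x, |u x| ^ (p - 2) * u x * lap d u x)
      = -(4 * (p - 1) / p) * ∫ x, ‖gradient (fun y => |u y| ^ (p / 2)) x‖ ^ 2 := by
  have hdiff : Differentiable ℝ u := hu.differentiable (by simp)
  have hgrad : ∀ x, gradient (fun y => |u y| ^ (p / 2)) x
      = (p / 2 * |u x| ^ ((p - 2) / 2) * Real.sign (u x)) • gradient u x := by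
    intro x
    rw [(hasDerivAt_abs_rpow_sign (by linarith : 1 < p / 2) (u x)).comp_gradient (hdiff x),
      show p / 2 - 1 = (p - 2) / 2 by ring]
  have hnorm : ∀ x, ‖gradient (fun y => |u y| ^ (p / 2)) x‖ ^ 2
      = p ^ 2 / 4 * (|u x| ^ (p - 2) * ‖gradient u x‖ ^ 2) := by
    intro x
    have hpow : (|u x| ^ ((p - 2) / 2)) ^ 2 = |u x| ^ (p - 2) := by
      rw [← Real.rpow_mul_natCast (abs_nonneg _)]
      norm_num
    have hsign : |u x| ^ (p - 2) * Real.sign (u x) ^ 2 = |u x| ^ (p - 2) := by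
      rcases lt_trichotomy (u x) 0 with h | h | h
      · simp [Real.sign_of_neg h]
      · simp [h, Real.zero_rpow (by linarith : p - 2 ≠ 0)]
      · simp [Real.sign_of_pos h]
    rw [hgrad x, norm_smul, mul_pow, Real.norm_eq_abs, sq_abs, mul_pow, mul_pow, hpow]
    linear_combination p ^ 2 / 4 * ‖gradient u x‖ ^ 2 * hsign
  have hparts : ∫ x, |u x| ^ (p - 2) * u x * lap d u x
      = -((p - 1) * ∫ x, |u x| ^ (p - 2) * ‖gradient u x‖ ^ 2) := by
    have hq : 0 < p - 2 := by linarith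
    rw [integral_comp_mul_lap (φ := fun t => |t| ^ (p - 2) * t)
      (hasDerivAt_abs_rpow_mul_self hq)
      (continuous_const.mul (continuous_abs.rpow_const fun _ => Or.inr hq.le))
      (contDiff_infty.1 hu 2) hsupp, ← integral_const_mul]
    congr 2 with x
    ring
  refine ⟨?_, hgrad, ?_, ?_⟩
  · exact (contDiff_infty.1 hu 1).norm_rpow (by linarith : 1 < p / 2)
  · rw [hparts]
    ring
  · simp_rw [hnorm]
    rw [integral_const_mul, hparts]
    have hp0 : p ≠ 0 := by linarith
    field_simp
end

section
/- Let d ≥ 2, p > 2, and let q satisfy dp/(p+d−2) < q ≤ p. Set q' = q/(q−1) and α = d(p−q)/(q(p−2)). There exists a constant C, depending only on d, p, and q, such that for every u ∈ C_c^∞(ℝ^d; ℝ) and every j ∈ {1, …, d}, ‖∂_j(|u|^{p−2}u)‖_{L^{q'}(ℝ^d)} ≤ C ‖|u|^{p/2}‖_{L²(ℝ^d)}^{(1−α)(p−2)/p} ‖∇(|u|^{p/2})‖_{L²(ℝ^d)}^{1+α(p−2)/p}. -/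
open MeasureTheory

open scoped NNReal ENNReal

/-- The Gagliardo–Nirenberg–Sobolev inequality for real exponents, in terms of integrals. -/
lemma exists_lintegral_rpow_le_lintegral_fderiv_rpow {E : Type*} [NormedAddCommGroup E]
    [NormedSpace ℝ E] [FiniteDimensional ℝ E] [MeasurableSpace E] [BorelSpace E]
    (μ : Measure E) [μ.IsAddHaarMeasure] {t : ℝ} (ht : 1 ≤ t) (htd : t < Module.finrank ℝ E) :
    ∃ C : ℝ≥0, ∀ w : E → ℝ, ContDiff ℝ 1 w → HasCompactSupport w →
      ∫⁻ x, ‖w x‖ₑ ^ (Module.finrank ℝ E * t / (Module.finrank ℝ E - t)) ∂μ ≤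
        C * (∫⁻ x, ‖fderiv ℝ w x‖ₑ ^ t ∂μ) ^
          ((Module.finrank ℝ E : ℝ) / (Module.finrank ℝ E - t)) := by
  lift t to ℝ≥0 using by linarith
  have ht0 : 0 < (t : ℝ) := by linarith
  set d : ℝ := (Module.finrank ℝ E : ℝ) with hd
  have hdt : 0 < d - t := by linarith
  have hd0 : 0 < d := by linarith
  obtain ⟨m, hm⟩ : ∃ m : ℝ≥0, (m : ℝ) = d * t / (d - t) :=
    ⟨⟨d * t / (d - t), by positivity⟩, rfl⟩
  have hm0 : 0 < (m : ℝ) := by rw [hm]; positivity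
  rw [← hm]
  refine ⟨eLpNormLESNormFDerivOfEqInnerConst μ t ^ (m : ℝ), fun w hw h2w => ?_⟩
  have key := eLpNorm_le_eLpNorm_fderiv_of_eq_inner μ hw h2w (p := t) (p' := m)
    (by exact_mod_cast ht) (Nat.cast_pos.mp (hd ▸ hd0)) (by
      rw [← hd, hm, NNReal.coe_inv]
      field_simp)
  rw [eLpNorm_eq_lintegral_rpow_enorm_toReal (by exact_mod_cast hm0.ne') ENNReal.coe_ne_top,
    eLpNorm_eq_lintegral_rpow_enorm_toReal (by exact_mod_cast ht0.ne') ENNReal.coe_ne_top] at key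
  simp only [ENNReal.coe_toReal] at key
  have key2 := ENNReal.rpow_le_rpow key hm0.le
  rw [← ENNReal.rpow_mul, one_div_mul_cancel hm0.ne', ENNReal.rpow_one,
    ENNReal.mul_rpow_of_nonneg _ _ hm0.le, ← ENNReal.rpow_mul,
    ← ENNReal.coe_rpow_of_nonneg _ hm0.le] at key2
  convert key2 using 3
  rw [hm]
  field_simp

/-- An `L^m` bound for `u`, with `m = pd / (d - t)`, in terms of `∫ |u| ^ p` and
`∫ |u| ^ (p - 2) |∇u| ^ 2`. -/
lemma exists_lintegral_rpow_le_mul_weighted_fderiv {E : Type*} [NormedAddCommGroup E]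
    [NormedSpace ℝ E] [FiniteDimensional ℝ E] [MeasurableSpace E] [BorelSpace E]
    (μ : Measure E) [μ.IsAddHaarMeasure] {p t : ℝ} (hp : 2 < p) (ht : 1 ≤ t) (ht2 : t < 2)
    (htd : t < Module.finrank ℝ E) :
    ∃ C : ℝ≥0, ∀ u : E → ℝ, ContDiff ℝ 1 u → HasCompactSupport u →
      ∫⁻ x, ‖u x‖ₑ ^ (p * Module.finrank ℝ E / (Module.finrank ℝ E - t)) ∂μ ≤
        C * ((∫⁻ x, ‖u x‖ₑ ^ p ∂μ) ^ (1 - t / 2) *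
          (∫⁻ x, ‖u x‖ₑ ^ (p - 2) * ‖fderiv ℝ u x‖ₑ ^ (2 : ℝ) ∂μ) ^ (t / 2)) ^
          ((Module.finrank ℝ E : ℝ) / (Module.finrank ℝ E - t)) := by
  obtain ⟨C, hC⟩ := exists_lintegral_rpow_le_lintegral_fderiv_rpow μ ht htd
  set d : ℝ := (Module.finrank ℝ E : ℝ)
  have ht0 : 0 < t := by linarith
  have hdt : 0 < d - t := by linarith
  have hd0 : 0 < d := by linarith
  have hr1 : 1 < p / t := by rw [one_lt_div ht0]; linarith
  set r : ℝ≥0 := ⟨p / t, by positivity⟩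
  have hrr : (r : ℝ) = p / t := rfl
  have hr1' : 1 < r := by exact_mod_cast hr1
  refine ⟨C * (r ^ t) ^ (d / (d - t)), fun u hu h2u => ?_⟩
  have hw : ContDiff ℝ 1 fun x => ‖u x‖ ^ (r : ℝ) := hu.norm_rpow hr1
  have h2w : HasCompactSupport fun x => ‖u x‖ ^ (r : ℝ) :=
    h2u.comp_left (g := fun y : ℝ => ‖y‖ ^ (r : ℝ))
      (by simp [Real.zero_rpow (by linarith : (r : ℝ) ≠ 0)])
  have hcu : Continuous u := hu.continuous
  have hcf : Continuous (fderiv ℝ u) := hu.continuous_fderiv one_ne_zero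
  have hgrad : ∫⁻ x, ‖fderiv ℝ (fun x => ‖u x‖ ^ (r : ℝ)) x‖ₑ ^ t ∂μ ≤
      (r ^ t : ℝ≥0) * ((∫⁻ x, ‖u x‖ₑ ^ p ∂μ) ^ (1 - t / 2) *
          (∫⁻ x, ‖u x‖ₑ ^ (p - 2) * ‖fderiv ℝ u x‖ₑ ^ (2 : ℝ) ∂μ) ^ (t / 2)) := by
    have hH := ENNReal.lintegral_mul_norm_pow_le (μ := μ) (f := fun x => ‖u x‖ₑ ^ p)
      (g := fun x => ‖u x‖ₑ ^ (p - 2) * ‖fderiv ℝ u x‖ₑ ^ (2 : ℝ))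
      (by fun_prop) (by fun_prop) (p := 1 - t / 2) (q := t / 2) (by linarith) (by linarith)
      (by ring)
    refine le_trans ?_ (mul_le_mul_right hH _)
    rw [← lintegral_const_mul' _ _ ENNReal.coe_ne_top]
    refine lintegral_mono fun x => ?_
    refine (ENNReal.rpow_le_rpow (enorm_fderiv_norm_rpow_le
      (hu.differentiable one_ne_zero) hr1') ht0.le).trans_eq ?_
    rw [ENNReal.mul_rpow_of_nonneg _ _ ht0.le, ENNReal.mul_rpow_of_nonneg _ _ ht0.le,
      ENNReal.mul_rpow_of_nonneg _ _ (by linarith : 0 ≤ t / 2), mul_assoc,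
      ENNReal.coe_rpow_of_nonneg _ ht0.le, ← mul_assoc (_ ^ _) (_ ^ _) (_ ^ (t / 2))]
    simp only [← ENNReal.rpow_mul]
    rw [← ENNReal.rpow_add_of_nonneg _ _ (by nlinarith) (by nlinarith), hrr]
    have h1 : (p / t - 1) * t = p * (1 - t / 2) + (p - 2) * (t / 2) := by
      field_simp
      ring
    have h2 : 2 * (t / 2) = t := by ring
    rw [h1, h2]
  calc _ = ∫⁻ x, ‖‖u x‖ ^ (r : ℝ)‖ₑ ^ (d * t / (d - t)) ∂μ := by
        refine lintegral_congr fun x => ?_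
        rw [Real.enorm_rpow_of_nonneg (norm_nonneg (u x)) r.coe_nonneg, enorm_norm, ← ENNReal.rpow_mul, hrr]
        congr 1
        field_simp
    _ ≤ _ := hC _ hw h2w
    _ ≤ C * ((r ^ t : ℝ≥0) * ((∫⁻ x, ‖u x‖ₑ ^ p ∂μ) ^ (1 - t / 2) *
          (∫⁻ x, ‖u x‖ₑ ^ (p - 2) * ‖fderiv ℝ u x‖ₑ ^ (2 : ℝ) ∂μ) ^ (t / 2))) ^ (d / (d - t)) := by
        gcongr
    _ = _ := by
        rw [ENNReal.mul_rpow_of_nonneg _ _ (by positivity), ENNReal.coe_mul,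
          ← ENNReal.coe_rpow_of_nonneg _ (by positivity), mul_assoc]

/-- The weighted interpolation inequality, with the optimal powers of `∫ |u| ^ p` and
`∫ |u| ^ (p - 2) |∇u| ^ 2`. -/
lemma exists_lintegral_weighted_fderiv_rpow_le {E : Type*} [NormedAddCommGroup E]
    [NormedSpace ℝ E] [FiniteDimensional ℝ E] [MeasurableSpace E] [BorelSpace E]
    (μ : Measure E) [μ.IsAddHaarMeasure] {p q : ℝ} (hd : 2 ≤ Module.finrank ℝ E) (hp : 2 < p)
    (hq : 2 < q) (hqp : q ≤ p)
    (hα : Module.finrank ℝ E * (p - q) / (q * (p - 2)) < 1) :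
    ∃ C : ℝ≥0, ∀ u : E → ℝ, ContDiff ℝ 1 u → HasCompactSupport u →
      (∫⁻ x, (‖u x‖ₑ ^ (p - 2) * ‖fderiv ℝ u x‖ₑ) ^ (q / (q - 1)) ∂μ) ^ ((q - 1) / q) ≤
        C * ((∫⁻ x, ‖u x‖ₑ ^ p ∂μ) ^
            ((1 - Module.finrank ℝ E * (p - q) / (q * (p - 2))) * (p - 2) / p / 2) *
          (∫⁻ x, ‖u x‖ₑ ^ (p - 2) * ‖fderiv ℝ u x‖ₑ ^ (2 : ℝ) ∂μ) ^
            ((1 + Module.finrank ℝ E * (p - q) / (q * (p - 2)) * (p - 2) / p) / 2)) := by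
  have hd2 : (2 : ℝ) ≤ Module.finrank ℝ E := by exact_mod_cast hd
  set α : ℝ := Module.finrank ℝ E * (p - q) / (q * (p - 2)) with hαd
  have hα0 : 0 ≤ α := div_nonneg (mul_nonneg (by linarith) (by linarith))
    (mul_nonneg (by linarith) (by linarith))
  obtain ⟨C, hC⟩ := exists_lintegral_rpow_le_mul_weighted_fderiv μ hp
    (by linarith : 1 ≤ 1 + α) (by linarith) (by linarith)
  set d : ℝ := (Module.finrank ℝ E : ℝ)
  obtain ⟨t, ht⟩ : ∃ t, t = 1 + α := ⟨_, rfl⟩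
  rw [← ht] at hC
  have hdt : 0 < d - t := by linarith
  have ht0 : 0 < t := by linarith
  obtain ⟨q', hq'⟩ : ∃ q', q' = q / (q - 1) := ⟨_, rfl⟩
  have hq1 : 0 < q - 1 := by linarith
  have hq'0 : 0 < q' := by rw [hq']; apply div_pos <;> linarith
  have hq'i : (q - 1) / q = 1 / q' := by rw [hq', one_div_div]
  obtain ⟨s, hs⟩ : ∃ s, s = (p - 2) / p := ⟨_, rfl⟩
  have hs0 : 0 < s := by rw [hs]; apply div_pos <;> linarith
  have hp2 : p - 2 ≠ 0 := by linarith
  have hps : p * s = p - 2 := by rw [hs]; field_simp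
  have hαs : α * s / d = 1 / q - 1 / p := by
    rw [hαd, hs]; field_simp
  have hq'' : 1 / q' = 1 - 1 / q := by rw [hq']; field_simp
  obtain ⟨a, ha⟩ : ∃ a, a = s * q' * (1 / 2 - α / t) := ⟨_, rfl⟩
  obtain ⟨b, hb⟩ : ∃ b, b = q' * α * s * (d - t) / (t * d) := ⟨_, rfl⟩
  have ha0 : 0 ≤ a := by
    rw [ha]
    refine mul_nonneg (by positivity) ?_
    rw [sub_nonneg, div_le_div_iff₀ ht0 two_pos]
    linarith
  have hb0 : 0 ≤ b := by rw [hb]; positivity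
  have hbd : b * (d / (d - t)) = q' * α * s / t := by rw [hb]; field_simp
  have hsum : q' / 2 + a + b = 1 := by
    have h1 : b = q' * (α * s / t - α * s / d) := by rw [hb]; field_simp
    have h2 : q' * (1 / q') = 1 := by field_simp
    have h3 : s = 1 - 2 * (1 / p) := by rw [hs]; field_simp
    rw [ha, h1, hαs]
    linear_combination q' / 2 * h3 + h2 - q' * hq''
  refine ⟨(C ^ b) ^ (1 / q'), fun u hu h2u => ?_⟩
  have hcu : Continuous u := hu.continuous
  have hcf : Continuous (fderiv ℝ u) := hu.continuous_fderiv one_ne_zero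
  have hCu := hC u hu h2u
  set A := ∫⁻ x, ‖u x‖ₑ ^ p ∂μ
  set B := ∫⁻ x, ‖u x‖ₑ ^ (p - 2) * ‖fderiv ℝ u x‖ₑ ^ (2 : ℝ) ∂μ
  set K := ∫⁻ x, ‖u x‖ₑ ^ (p * d / (d - t)) ∂μ
  have hH : ∫⁻ x, (‖u x‖ₑ ^ (p - 2) * ‖fderiv ℝ u x‖ₑ) ^ q' ∂μ ≤ B ^ (q' / 2) * A ^ a * K ^ b := by
    have := ENNReal.lintegral_prod_norm_pow_le (μ := μ) (Finset.univ : Finset (Fin 3))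
      (f := ![fun x => ‖u x‖ₑ ^ (p - 2) * ‖fderiv ℝ u x‖ₑ ^ (2 : ℝ), fun x => ‖u x‖ₑ ^ p,
        fun x => ‖u x‖ₑ ^ (p * d / (d - t))]) (p := ![q' / 2, a, b])
      (by
        intro i _
        fin_cases i
        · simp; fun_prop
        · simp; fun_prop
        · simp; fun_prop)
      (by simpa [Fin.sum_univ_three] using hsum)
      (by
        intro i _
        fin_cases i
        · simp; positivity
        · simpa using ha0
        · simpa using hb0)
    simp only [Fin.prod_univ_three, Matrix.cons_val] at this
    refine le_trans (le_of_eq (lintegral_congr fun x => ?_)) this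
    rw [ENNReal.mul_rpow_of_nonneg _ _ hq'0.le, ENNReal.mul_rpow_of_nonneg _ _ (by positivity)]
    simp only [← ENNReal.rpow_mul]
    have hperm (x y z w : ℝ≥0∞) : x * y * z * w = x * z * w * y := by ring
    rw [hperm, ← ENNReal.rpow_add_of_nonneg _ ((p : ℝ) * a)
      (mul_nonneg (by linarith) (by positivity)) (mul_nonneg (by linarith) ha0),
      ← ENNReal.rpow_add_of_nonneg]
    · congr 2
      · rw [ha]
        linear_combination (-p) * hbd - q' / 2 * hps
      · ring
    · have : 0 ≤ p * a := mul_nonneg (by linarith) ha0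
      have : 0 ≤ (p - 2) * (q' / 2) := mul_nonneg (by linarith) (by positivity)
      linarith
    · exact mul_nonneg (div_nonneg (mul_nonneg (by linarith) (by linarith)) hdt.le) hb0
  have h1 : 0 ≤ 1 - t / 2 := by linarith
  have h2 : 0 ≤ 1 / q' := by positivity
  have h3 : 0 ≤ d / (d - t) := div_nonneg (by linarith) hdt.le
  rw [hq'i]
  calc (∫⁻ x, (‖u x‖ₑ ^ (p - 2) * ‖fderiv ℝ u x‖ₑ) ^ (q / (q - 1)) ∂μ) ^ (1 / q')
      ≤ (B ^ (q' / 2) * A ^ a * (C * (A ^ (1 - t / 2) * B ^ (t / 2)) ^ (d / (d - t))) ^ b) ^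
          (1 / q') := by
        rw [← hq']
        refine ENNReal.rpow_le_rpow (hH.trans ?_) h2
        gcongr
    _ = ((C : ℝ≥0∞) ^ b * (A ^ (a + (1 - t / 2) * (d / (d - t)) * b) *
          B ^ (q' / 2 + t / 2 * (d / (d - t)) * b))) ^ (1 / q') := by
        rw [ENNReal.rpow_add_of_nonneg _ _ ha0 (by positivity),
          ENNReal.rpow_add_of_nonneg _ _ (by positivity) (by positivity),
          ENNReal.mul_rpow_of_nonneg _ _ hb0, ENNReal.mul_rpow_of_nonneg _ _ h3,
          ENNReal.mul_rpow_of_nonneg _ _ hb0]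
        simp only [← ENNReal.rpow_mul, mul_assoc]
        ring_nf
    _ = _ := by
        rw [ENNReal.mul_rpow_of_nonneg _ _ h2, ENNReal.mul_rpow_of_nonneg _ _ h2,
          ENNReal.coe_rpow_of_nonneg _ h2, ENNReal.coe_rpow_of_nonneg _ hb0]
        simp only [← ENNReal.rpow_mul]
        congr 3
        · rw [mul_assoc (1 - t / 2), mul_comm _ b, hbd, ha, mul_div_assoc _ (p - 2) p, ← hs]
          field_simp
          ring
        · rw [mul_assoc (t / 2), mul_comm _ b, hbd, mul_div_assoc _ (p - 2) p, ← hs]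
          field_simp
/-- For `r > 0` the function `y ↦ |y| ^ r * y` is differentiable, including at the origin. -/
lemma hasDerivAt_abs_rpow_mul_self_s11 {r : ℝ} (hr : 0 < r) (y : ℝ) :
    HasDerivAt (fun y : ℝ => |y| ^ r * y) ((r + 1) * |y| ^ r) y := by
  rcases eq_or_ne y 0 with rfl | hy
  · have hcont : Filter.Tendsto (fun y : ℝ => |y| ^ r) (nhdsWithin 0 {0}ᶜ) (nhds 0) := by
      have : Continuous fun y : ℝ => |y| ^ r := continuous_abs.rpow_const fun _ => Or.inr hr.le
      simpa [Real.zero_rpow hr.ne'] using (this.tendsto 0).mono_left nhdsWithin_le_nhds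
    rw [hasDerivAt_iff_tendsto_slope_zero]
    simp only [abs_zero, Real.zero_rpow hr.ne', mul_zero]
    refine hcont.congr' ?_
    filter_upwards [self_mem_nhdsWithin] with t ht
    have ht' : t ≠ 0 := ht
    simp only [zero_add, sub_zero, smul_eq_mul]
    field_simp
  · have h := ((hasDerivAt_abs hy).rpow_const (p := r) (Or.inl (abs_ne_zero.mpr hy))).mul
      (hasDerivAt_id y)
    refine h.congr_deriv ?_
    have h1 : |y| ^ r = |y| ^ (r - 1) * |y| := by
      rw [← Real.rpow_add_one (abs_ne_zero.mpr hy), sub_add_cancel]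
    have h2 : (SignType.sign y : ℝ) * y = |y| := sign_mul_self y
    simp only [id]
    rw [h1]
    linear_combination r * |y| ^ (r - 1) * h2

/-- A nonnegative continuous function with compact support has a finite Lebesgue integral, which
agrees with its Bochner integral. -/
lemma lintegral_ofReal_ne_top_and_integral_eq_toReal {E : Type*} [TopologicalSpace E]
    [MeasurableSpace E] [OpensMeasurableSpace E] (μ : Measure E) [IsFiniteMeasureOnCompacts μ]
    {g : E → ℝ} (hg : Continuous g) (hg0 : ∀ x, 0 ≤ g x) (hgs : HasCompactSupport g) :
    ∫⁻ x, ENNReal.ofReal (g x) ∂μ ≠ ⊤ ∧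
      ∫ x, g x ∂μ = (∫⁻ x, ENNReal.ofReal (g x) ∂μ).toReal := by
  have hint : Integrable g μ := hg.integrable_of_hasCompactSupport hgs
  exact ⟨hint.lintegral_lt_top.ne,
    integral_eq_lintegral_of_nonneg_ae (Filter.Eventually.of_forall hg0) hint.1⟩

lemma norm_fderiv_abs_rpow_sq {E : Type*} [NormedAddCommGroup E] [NormedSpace ℝ E]
    {u : E → ℝ} {x : E} (hu : DifferentiableAt ℝ u x) {p : ℝ} (hp : 2 < p) :
    ‖fderiv ℝ (fun y => |u y| ^ (p / 2)) x‖ ^ (2 : ℝ) =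
      (p / 2) ^ 2 * (|u x| ^ (p - 2) * ‖fderiv ℝ u x‖ ^ (2 : ℝ)) := by
  have hderiv : HasFDerivAt (fun y => |u y| ^ (p / 2)) _ x :=
    (hasDerivAt_abs_rpow (u x) (by linarith : 1 < p / 2)).comp_hasFDerivAt x hu.hasFDerivAt
  rw [hderiv.fderiv, norm_smul, Real.norm_eq_abs, abs_mul, abs_mul,
    abs_of_pos (by linarith : 0 < p / 2), abs_of_nonneg (Real.rpow_nonneg (abs_nonneg _) _)]
  have h : (|u x| ^ (p / 2 - 2) * |u x|) ^ 2 = |u x| ^ (p - 2) := by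
    rcases eq_or_ne (u x) 0 with h0 | h0
    · simp [h0, Real.zero_rpow (by linarith : p - 2 ≠ 0)]
    · rw [← Real.rpow_add_one (abs_ne_zero.mpr h0), ← Real.rpow_mul_natCast (abs_nonneg _)]
      congr 1
      push_cast
      ring
  rw [← h]
  simp only [Real.rpow_two]
  ring

/-- Gagliardo–Nirenberg-type estimate: for `d ≥ 2`, `p > 2` and `dp/(p+d−2) < q ≤ p`,
with `q' = q/(q−1)` and `α = d(p−q)/(q(p−2))`, there is a constant `C`, depending only on
`d`, `p` and `q`, such that for every `u ∈ C_c^∞(ℝ^d)` and every `j`,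
`‖∂_j(|u|^{p−2}u)‖_{q'} ≤ C ‖|u|^{p/2}‖₂^{(1−α)(p−2)/p} ‖∇(|u|^{p/2})‖₂^{1+α(p−2)/p}`. -/
theorem deriv_power_interpolation (d : ℕ) (hd : 2 ≤ d) (p q : ℝ) (hp : 2 < p)
    (hq1 : (d : ℝ) * p / (p + (d : ℝ) - 2) < q) (hq2 : q ≤ p) :
    ∃ C : ℝ, 0 < C ∧
      ∀ u : EuclideanSpace ℝ (Fin d) → ℝ, ContDiff ℝ (⊤ : ℕ∞) u → HasCompactSupport u →
        ∀ j : Fin d,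
          (∫ x, |fderiv ℝ (fun y => |u y| ^ (p - 2) * u y) x (EuclideanSpace.single j 1)| ^
              (q / (q - 1))) ^ ((q - 1) / q)
            ≤ C * ((∫ x, (|u x| ^ (p / 2)) ^ (2 : ℝ)) ^ ((1 : ℝ) / 2)) ^
                  ((1 - (d : ℝ) * (p - q) / (q * (p - 2))) * (p - 2) / p) *
                ((∫ x, ‖gradient (fun y => |u y| ^ (p / 2)) x‖ ^ (2 : ℝ)) ^ ((1 : ℝ) / 2)) ^
                  (1 + ((d : ℝ) * (p - q) / (q * (p - 2))) * (p - 2) / p) := by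
  have hd2 : (2 : ℝ) ≤ d := by exact_mod_cast hd
  have hq1' : (d : ℝ) * p < q * (p + d - 2) := (div_lt_iff₀ (by linarith)).mp hq1
  have hq : 2 < q := by
    have : 2 * (p + d - 2) < q * (p + d - 2) := by nlinarith
    exact lt_of_mul_lt_mul_right this (by linarith)
  have hα0 : 0 ≤ (d : ℝ) * (p - q) / (q * (p - 2)) :=
    div_nonneg (mul_nonneg (by linarith) (by linarith)) (mul_nonneg (by linarith) (by linarith))
  have hα : (d : ℝ) * (p - q) / (q * (p - 2)) < 1 := by
    rw [div_lt_one (mul_pos (by linarith) (by linarith))]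
    linarith
  have hfr : Module.finrank ℝ (EuclideanSpace ℝ (Fin d)) = d := by simp
  obtain ⟨C, hC⟩ := exists_lintegral_weighted_fderiv_rpow_le
    (volume : Measure (EuclideanSpace ℝ (Fin d))) (hfr.symm ▸ hd) hp hq hq2 (hfr.symm ▸ hα)
  rw [hfr] at hC
  set α : ℝ := (d : ℝ) * (p - q) / (q * (p - 2))
  refine ⟨(p - 1) * (C + 1), mul_pos (by linarith) (by positivity), fun u hu h2u j => ?_⟩
  have hu1 : ContDiff ℝ 1 u := hu.of_le (by exact_mod_cast le_top)
  have hdu : Differentiable ℝ u := hu1.differentiable one_ne_zero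
  have hcu : Continuous u := hu1.continuous
  have hcf : Continuous (fderiv ℝ u) := hu1.continuous_fderiv one_ne_zero
  have hCu := hC u hu1 h2u
  have hq'0 : 0 < q / (q - 1) := div_pos (by linarith) (by linarith)
  have hq'i : 0 ≤ (q - 1) / q := div_nonneg (by linarith) (by linarith)
  have heA : 0 ≤ (1 - α) * (p - 2) / p / 2 := by
    have : 0 ≤ (1 - α) * (p - 2) := mul_nonneg (by linarith) (by linarith)
    positivity
  have heB : 0 ≤ (1 + α * (p - 2) / p) / 2 := by
    have : 0 ≤ α * (p - 2) := mul_nonneg hα0 (by linarith)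
    positivity
  have hcp : Continuous fun x => |u x| ^ p :=
    hcu.abs.rpow_const fun _ => Or.inr (by linarith)
  have hcp2 : Continuous fun x => |u x| ^ (p - 2) :=
    hcu.abs.rpow_const fun _ => Or.inr (by linarith)
  obtain ⟨hA, hA'⟩ := lintegral_ofReal_ne_top_and_integral_eq_toReal volume hcp
    (fun x => by positivity) (h2u.comp_left (g := fun y : ℝ => |y| ^ p)
      (by simp [Real.zero_rpow (by linarith : p ≠ 0)]))
  obtain ⟨hB, hB'⟩ := lintegral_ofReal_ne_top_and_integral_eq_toReal volume
    (g := fun x => |u x| ^ (p - 2) * ‖fderiv ℝ u x‖ ^ (2 : ℝ))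
    (hcp2.mul (hcf.norm.rpow_const fun _ => Or.inr (by norm_num)))
    (fun x => by positivity) (HasCompactSupport.mul_right (h2u.comp_left
      (g := fun y : ℝ => |y| ^ (p - 2)) (by simp [Real.zero_rpow (by linarith : p - 2 ≠ 0)])))
  have hAe : ∫⁻ x, ‖u x‖ₑ ^ p = ∫⁻ x, ENNReal.ofReal (|u x| ^ p) := by
    refine lintegral_congr fun x => ?_
    rw [← ENNReal.ofReal_rpow_of_nonneg (abs_nonneg _) (by linarith), Real.enorm_eq_ofReal_abs]
  have hBe : ∫⁻ x, ‖u x‖ₑ ^ (p - 2) * ‖fderiv ℝ u x‖ₑ ^ (2 : ℝ) =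
      ∫⁻ x, ENNReal.ofReal (|u x| ^ (p - 2) * ‖fderiv ℝ u x‖ ^ (2 : ℝ)) := by
    refine lintegral_congr fun x => ?_
    rw [ENNReal.ofReal_mul (by positivity),
      ← ENNReal.ofReal_rpow_of_nonneg (abs_nonneg _) (by linarith), Real.enorm_eq_ofReal_abs,
      ← ENNReal.ofReal_rpow_of_nonneg (norm_nonneg _) (by norm_num), ofReal_norm]
  rw [hAe, hBe] at hCu
  set A := ∫⁻ x, ENNReal.ofReal (|u x| ^ p)
  set B := ∫⁻ x, ENNReal.ofReal (|u x| ^ (p - 2) * ‖fderiv ℝ u x‖ ^ (2 : ℝ))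
  have hF : ∀ x, fderiv ℝ (fun y => |u y| ^ (p - 2) * u y) x (EuclideanSpace.single j 1) =
      (p - 1) * |u x| ^ (p - 2) * fderiv ℝ u x (EuclideanSpace.single j 1) := fun x => by
    have hderiv : HasFDerivAt (fun y => |u y| ^ (p - 2) * u y) _ x :=
      (hasDerivAt_abs_rpow_mul_self_s11 (by linarith : 0 < p - 2) (u x)).comp_hasFDerivAt x
        (hdu x).hasFDerivAt
    rw [hderiv.fderiv]
    simp only [smul_apply, smul_eq_mul]
    ring
  have hAint : ∫ x, (|u x| ^ (p / 2)) ^ (2 : ℝ) = A.toReal := by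
    rw [← hA']
    congr 1 with x
    rw [← Real.rpow_mul (abs_nonneg _), div_mul_cancel₀ _ two_ne_zero]
  have hBint : B.toReal ≤ ∫ x, ‖gradient (fun y => |u y| ^ (p / 2)) x‖ ^ (2 : ℝ) := by
    have hgr : ∀ x, ‖gradient (fun y => |u y| ^ (p / 2)) x‖ ^ (2 : ℝ) =
        (p / 2) ^ 2 * (|u x| ^ (p - 2) * ‖fderiv ℝ u x‖ ^ (2 : ℝ)) := fun x => by
      rw [gradient, LinearIsometryEquiv.norm_map, norm_fderiv_abs_rpow_sq (hdu x) hp]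
    simp only [hgr]
    rw [integral_const_mul, hB']
    exact le_mul_of_one_le_left ENNReal.toReal_nonneg (one_le_pow₀ (by linarith))
  set X := ∫⁻ x, (‖u x‖ₑ ^ (p - 2) * ‖fderiv ℝ u x‖ₑ) ^ (q / (q - 1))
  have hp1 : 0 ≤ p - 1 := by linarith
  have hFX : ∫⁻ x, ENNReal.ofReal
      (|(p - 1) * |u x| ^ (p - 2) * fderiv ℝ u x (EuclideanSpace.single j 1)| ^ (q / (q - 1))) ≤
      ENNReal.ofReal (p - 1) ^ (q / (q - 1)) * X := by
    rw [← lintegral_const_mul' _ _ (ENNReal.rpow_ne_top_of_nonneg hq'0.le ENNReal.ofReal_ne_top)]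
    refine lintegral_mono fun x => ?_
    have hle : ‖fderiv ℝ u x (EuclideanSpace.single j 1)‖ₑ ≤ ‖fderiv ℝ u x‖ₑ := by
      refine (ContinuousLinearMap.le_opENorm _ _).trans_eq ?_
      rw [← ofReal_norm (EuclideanSpace.single j (1 : ℝ)), PiLp.norm_single]
      simp
    rw [← ENNReal.mul_rpow_of_nonneg _ _ hq'0.le,
      ← ENNReal.ofReal_rpow_of_nonneg (abs_nonneg _) hq'0.le, ← Real.enorm_eq_ofReal_abs,
      enorm_mul, enorm_mul, Real.enorm_of_nonneg hp1,
      Real.enorm_rpow_of_nonneg (abs_nonneg _) (by linarith), Real.enorm_abs, mul_assoc]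
    gcongr
  have hY : (C : ℝ≥0∞) * (A ^ ((1 - α) * (p - 2) / p / 2) * B ^ ((1 + α * (p - 2) / p) / 2)) ≠ ⊤ :=
    ENNReal.mul_ne_top ENNReal.coe_ne_top (ENNReal.mul_ne_top
      (ENNReal.rpow_ne_top_of_nonneg heA hA) (ENNReal.rpow_ne_top_of_nonneg heB hB))
  have hmeas : AEStronglyMeasurable (fun x => |(p - 1) * |u x| ^ (p - 2) *
      fderiv ℝ u x (EuclideanSpace.single j 1)| ^ (q / (q - 1))) volume :=
    ((((continuous_const.mul hcp2).mul (hcf.clm_apply continuous_const)).abs).rpow_const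
      fun _ => Or.inr hq'0.le).aestronglyMeasurable
  have hBpow : B.toReal ^ ((1 + α * (p - 2) / p) / 2) ≤
      ((∫ x, ‖gradient (fun y => |u y| ^ (p / 2)) x‖ ^ (2 : ℝ)) ^ ((1 : ℝ) / 2)) ^
        (1 + α * (p - 2) / p) := by
    rw [← Real.rpow_mul (ENNReal.toReal_nonneg.trans hBint), one_div_mul_eq_div]
    exact Real.rpow_le_rpow ENNReal.toReal_nonneg hBint heB
  have hApow : (A.toReal ^ ((1 : ℝ) / 2)) ^ ((1 - α) * (p - 2) / p) =
      A.toReal ^ ((1 - α) * (p - 2) / p / 2) := by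
    rw [← Real.rpow_mul ENNReal.toReal_nonneg, one_div_mul_eq_div]
  simp only [hF]
  rw [hAint, hApow, integral_eq_lintegral_of_nonneg_ae
    (Filter.Eventually.of_forall fun x => by positivity) hmeas, ENNReal.toReal_rpow]
  calc _ ≤ (ENNReal.ofReal (p - 1) * (C * (A ^ ((1 - α) * (p - 2) / p / 2) *
          B ^ ((1 + α * (p - 2) / p) / 2)))).toReal := by
        refine ENNReal.toReal_mono (ENNReal.mul_ne_top ENNReal.ofReal_ne_top hY) ?_
        refine (ENNReal.rpow_le_rpow hFX hq'i).trans ?_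
        rw [ENNReal.mul_rpow_of_nonneg _ _ hq'i, ← ENNReal.rpow_mul,
          div_mul_div_cancel₀ (by linarith : q - 1 ≠ 0), div_self (by linarith), ENNReal.rpow_one]
        gcongr
    _ = (p - 1) * C * A.toReal ^ ((1 - α) * (p - 2) / p / 2) *
          B.toReal ^ ((1 + α * (p - 2) / p) / 2) := by
        rw [ENNReal.toReal_mul, ENNReal.toReal_mul, ENNReal.toReal_mul, ENNReal.toReal_ofReal hp1,
          ENNReal.coe_toReal, ENNReal.toReal_rpow, ENNReal.toReal_rpow]
        ring
    _ ≤ _ := by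
        gcongr
        linarith
end
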